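/- arXiv:hep-th/0009200 — 5 statements merged into one kernel-verified Lean document; each statement's English description precedes it below -/
import Mathlib

section
/- Let 0 ≤ k ≤ n−1 and λ ∈ ℂ, λ ≠ 0. If ω ∈ V_k satisfies Δ_k ω = λω and d_{k−1}† ω = 0, then Δ_{k+1}(d_k ω) = λ·d_k ω and d_{k+1}(d_k ω) = 0. Moreover, d_k maps E_k″(λ) := ker(Δ_k − λ) ∩ ker(d_{k−1}†) bijectively onto E_{k+1}′(λ) := ker(Δ_{k+1} − λ) ∩ ker(d_{k+1}). -/
open LinearMap Module

variable {V : ℕ → Type}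

/-- `d_{k-1} ∘ d_{k-1}†`, with the convention `d_{-1} = 0`. -/
noncomputable def ddAdj [∀ k, NormedAddCommGroup (V k)] [∀ k, InnerProductSpace ℂ (V k)]
    [∀ k, FiniteDimensional ℂ (V k)] (d : ∀ k, V k →ₗ[ℂ] V (k + 1)) :
    ∀ k, V k →ₗ[ℂ] V k
  | 0 => 0
  | k + 1 => (d k).comp (LinearMap.adjoint (d k))

/-- The Laplacian `Δ_k = d_{k-1} ∘ d_{k-1}† + d_k† ∘ d_k` (conventions `d_{-1} = 0`,
and `d_n = 0` is imposed as a hypothesis in the theorems). -/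
noncomputable def Lap [∀ k, NormedAddCommGroup (V k)] [∀ k, InnerProductSpace ℂ (V k)]
    [∀ k, FiniteDimensional ℂ (V k)] (d : ∀ k, V k →ₗ[ℂ] V (k + 1)) (k : ℕ) :
    V k →ₗ[ℂ] V k :=
  ddAdj d k + (LinearMap.adjoint (d k)).comp (d k)

open Classical in
/-- `det′ f`: the determinant of the restriction of `f` to `(ker f)ᗮ` (for `f` mapping
`(ker f)ᗮ` into itself), with `det′ f = 1` when `f = 0`. -/
noncomputable def detPrime {W : Type} [NormedAddCommGroup W] [InnerProductSpace ℂ W]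
    [FiniteDimensional ℂ W] (f : W →ₗ[ℂ] W) : ℂ :=
  if h : ∀ x ∈ (LinearMap.ker f)ᗮ, f x ∈ (LinearMap.ker f)ᗮ then
    LinearMap.det (f.restrict h)
  else 1

/-- `range d_{k-1}` as a subspace of `V k`, with the convention `d_{-1} = 0`. -/
noncomputable def rangePrev [∀ k, NormedAddCommGroup (V k)] [∀ k, InnerProductSpace ℂ (V k)]
    [∀ k, FiniteDimensional ℂ (V k)] (d : ∀ k, V k →ₗ[ℂ] V (k + 1)) :
    ∀ k, Submodule ℂ (V k)
  | 0 => ⊥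
  | k + 1 => LinearMap.range (d k)

/-- `ker d_{k-1}†` as a subspace of `V k`, with the convention `d_{-1} = 0`. -/
noncomputable def kerAdjPrev [∀ k, NormedAddCommGroup (V k)] [∀ k, InnerProductSpace ℂ (V k)]
    [∀ k, FiniteDimensional ℂ (V k)] (d : ∀ k, V k →ₗ[ℂ] V (k + 1)) :
    ∀ k, Submodule ℂ (V k)
  | 0 => ⊤
  | k + 1 => LinearMap.ker (LinearMap.adjoint (d k))

section

variable [∀ k, NormedAddCommGroup (V k)] [∀ k, InnerProductSpace ℂ (V k)]
    [∀ k, FiniteDimensional ℂ (V k)] {d : ∀ k, V k →ₗ[ℂ] V (k + 1)}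

theorem ddAdj_apply_eq_zero {k : ℕ} {ω : V k} (h : ω ∈ kerAdjPrev d k) :
    ddAdj d k ω = 0 := by
  cases k with
  | zero => rfl
  | succ k =>
    have h' : LinearMap.adjoint (d k) ω = 0 := h
    simp [ddAdj, h']

theorem Lap_apply_of_mem_kerAdjPrev {k : ℕ} {ω : V k} (h : ω ∈ kerAdjPrev d k) :
    Lap d k ω = LinearMap.adjoint (d k) (d k ω) := by
  simp [Lap, ddAdj_apply_eq_zero h]

theorem Lap_succ_apply_of_mem_ker {k : ℕ} {η : V (k + 1)} (h : d (k + 1) η = 0) :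
    Lap d (k + 1) η = d k (LinearMap.adjoint (d k) η) := by
  simp [Lap, ddAdj, h]

theorem adjoint_apply_mem_kerAdjPrev (hcomp : ∀ k, (d (k + 1)).comp (d k) = 0) (k : ℕ)
    (η : V (k + 1)) : LinearMap.adjoint (d k) η ∈ kerAdjPrev d k := by
  cases k with
  | zero => exact Submodule.mem_top
  | succ k =>
    change LinearMap.adjoint (d k) (LinearMap.adjoint (d (k + 1)) η) = 0
    rw [← LinearMap.comp_apply, ← LinearMap.adjoint_comp, hcomp, map_zero, LinearMap.zero_apply]

theorem mem_ker_sub_smul_id {W : Type*} [AddCommGroup W] [Module ℂ W] {f : W →ₗ[ℂ] W} {c : ℂ}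
    {x : W} : x ∈ LinearMap.ker (f - c • LinearMap.id) ↔ f x = c • x := by
  simp [sub_eq_zero]

end

/-- For an acyclic complex of finite-dimensional complex inner product
spaces, let `0 ≤ k ≤ n−1` and `lam ≠ 0`.  If `ω ∈ V_k` satisfies `Δ_k ω = lam·ω` and
`d_{k−1}† ω = 0`, then `Δ_{k+1}(d_k ω) = lam·(d_k ω)` and `d_{k+1}(d_k ω) = 0`.  Moreover
`d_k` maps `E_k″(lam) = ker (Δ_k − lam) ∩ ker d_{k−1}†` bijectively onto
`E_{k+1}′(lam) = ker (Δ_{k+1} − lam) ∩ ker d_{k+1}`. -/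
theorem stmt10 [∀ k, NormedAddCommGroup (V k)] [∀ k, InnerProductSpace ℂ (V k)]
    [∀ k, FiniteDimensional ℂ (V k)]
    (n : ℕ) (d : ∀ k, V k →ₗ[ℂ] V (k + 1))
    (hcomp : ∀ k, (d (k + 1)).comp (d k) = 0)
    (hzero : ∀ k, n ≤ k → d k = 0)
    (hker0 : LinearMap.ker (d 0) = ⊥)
    (hacyc : ∀ k, k < n → LinearMap.ker (d (k + 1)) = LinearMap.range (d k))
    (k : ℕ) (hk : k < n) (lam : ℂ) (hlam : lam ≠ 0) :
    (∀ ω : V k, Lap d k ω = lam • ω → ω ∈ kerAdjPrev d k →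
      Lap d (k + 1) (d k ω) = lam • d k ω ∧ d (k + 1) (d k ω) = 0) ∧
    Set.BijOn (d k)
      ((LinearMap.ker (Lap d k - lam • LinearMap.id) ⊓ kerAdjPrev d k : Submodule ℂ (V k)) :
        Set (V k))
      ((LinearMap.ker (Lap d (k + 1) - lam • LinearMap.id) ⊓ LinearMap.ker (d (k + 1)) :
        Submodule ℂ (V (k + 1))) : Set (V (k + 1))) := by
  have hdd (ω : V k) : d (k + 1) (d k ω) = 0 := LinearMap.congr_fun (hcomp k) ω
  have heigen (ω : V k) (hω : Lap d k ω = lam • ω) (hω' : ω ∈ kerAdjPrev d k) :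
      Lap d (k + 1) (d k ω) = lam • d k ω := by
    rw [Lap_succ_apply_of_mem_ker (hdd ω), ← Lap_apply_of_mem_kerAdjPrev hω', hω, map_smul]
  refine ⟨fun ω hω hω' => ⟨heigen ω hω hω', hdd ω⟩, ?_, ?_, ?_⟩
  · rintro ω ⟨hω, hω'⟩
    exact ⟨mem_ker_sub_smul_id.2 (heigen ω (mem_ker_sub_smul_id.1 hω) hω'), hdd ω⟩
  · intro x hx y hy hxy
    obtain ⟨hz, hz'⟩ := Submodule.sub_mem _ hx hy
    have h := mem_ker_sub_smul_id.1 hz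
    rw [Lap_apply_of_mem_kerAdjPrev hz', map_sub, hxy, sub_self, map_zero] at h
    exact sub_eq_zero.1 ((smul_eq_zero.1 h.symm).resolve_left hlam)
  · rintro η ⟨hη, hη'⟩
    have hmem : lam⁻¹ • LinearMap.adjoint (d k) η ∈ kerAdjPrev d k :=
      Submodule.smul_mem _ _ (adjoint_apply_mem_kerAdjPrev hcomp k η)
    have himage : d k (lam⁻¹ • LinearMap.adjoint (d k) η) = η := by
      rw [map_smul, ← Lap_succ_apply_of_mem_ker hη', mem_ker_sub_smul_id.1 hη,
        inv_smul_smul₀ hlam]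
    refine ⟨_, ⟨mem_ker_sub_smul_id.2 ?_, hmem⟩, himage⟩
    rw [Lap_apply_of_mem_kerAdjPrev hmem, himage, smul_inv_smul₀ hlam]
end

section
/- For every 0 ≤ k ≤ n, the Laplacian Δ_k is invertible and det(Δ_k) = det′(d_{k−1} ∘ d_{k−1}†) · det′(d_k† ∘ d_k). -/
open LinearMap Module

variable {V : ℕ → Type}

/-- The determinant of an endomorphism preserving two complementary subspaces is the product of the
determinants of its restrictions. -/
theorem LinearMap.det_eq_det_restrict_mul_det_restrict {K W : Type*} [Field K] [AddCommGroup W]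
    [Module K W] [FiniteDimensional K W] {p q : Submodule K W} (hpq : IsCompl p q)
    (f : W →ₗ[K] W) (hp : ∀ x ∈ p, f x ∈ p) (hq : ∀ x ∈ q, f x ∈ q) :
    LinearMap.det f = LinearMap.det (f.restrict hp) * LinearMap.det (f.restrict hq) := by
  rw [← LinearMap.det_prodMap, ← LinearMap.det_conj _ (Submodule.prodEquivOfIsCompl p q hpq)]
  congr 1
  refine LinearMap.ext fun x => ?_
  obtain ⟨y, rfl⟩ := (Submodule.prodEquivOfIsCompl p q hpq).surjective x
  simp

section SymmetricPair

variable {W : Type} [NormedAddCommGroup W] [InnerProductSpace ℂ W]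

theorem LinearMap.IsSymmetric.apply_mem_orthogonal_ker {A : W →ₗ[ℂ] W} (hA : A.IsSymmetric)
    (x : W) : A x ∈ (LinearMap.ker A)ᗮ := fun y hy => by
  rw [← hA y x, LinearMap.mem_ker.1 hy, inner_zero_left]

variable [FiniteDimensional ℂ W]

theorem detPrime_eq_det_restrict {A : W →ₗ[ℂ] W}
    (h : ∀ x ∈ (LinearMap.ker A)ᗮ, A x ∈ (LinearMap.ker A)ᗮ) :
    detPrime A = LinearMap.det (A.restrict h) :=
  dif_pos h

/-- If `ker A` and `ker B` are orthogonal complements of each other, then the sum of the symmetric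
operators `A` and `B` is invertible, with determinant `det′ A * det′ B`. -/
theorem bijective_add_and_det_add_eq {A B : W →ₗ[ℂ] W} (hA : A.IsSymmetric) (hB : B.IsSymmetric)
    (hAB : LinearMap.ker A = (LinearMap.ker B)ᗮ) :
    Function.Bijective (A + B) ∧ LinearMap.det (A + B) = detPrime A * detPrime B := by
  have hBA : (LinearMap.ker A)ᗮ = LinearMap.ker B := by
    rw [hAB, Submodule.orthogonal_orthogonal]
  have hc : IsCompl (LinearMap.ker A)ᗮ (LinearMap.ker B)ᗮ := by
    rw [hBA]
    exact Submodule.isCompl_orthogonal _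
  have hA0 : ∀ x ∈ (LinearMap.ker B)ᗮ, A x = 0 := fun x hx => by
    rwa [← hAB, LinearMap.mem_ker] at hx
  have hB0 : ∀ x ∈ (LinearMap.ker A)ᗮ, B x = 0 := fun x hx => by
    rwa [hBA, LinearMap.mem_ker] at hx
  constructor
  · have hinj : Function.Injective (A + B) := by
      rw [injective_iff_map_eq_zero]
      intro x hx
      rw [LinearMap.add_apply, add_eq_zero_iff_eq_neg] at hx
      have hAx : A x = 0 := by
        refine Submodule.disjoint_def.1 hc.disjoint _ (hA.apply_mem_orthogonal_ker x) ?_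
        rw [hx]
        exact Submodule.neg_mem _ (hB.apply_mem_orthogonal_ker x)
      have hBx : B x = 0 := by
        rwa [hAx, eq_comm, neg_eq_zero] at hx
      refine Submodule.disjoint_def.1 hc.disjoint x ?_ ?_
      · rwa [hBA]
      · rwa [← hAB]
    exact ⟨hinj, LinearMap.injective_iff_surjective.1 hinj⟩
  · have hp : ∀ x ∈ (LinearMap.ker A)ᗮ, (A + B) x ∈ (LinearMap.ker A)ᗮ := fun x hx => by
      simpa [hB0 x hx] using hA.apply_mem_orthogonal_ker x
    have hq : ∀ x ∈ (LinearMap.ker B)ᗮ, (A + B) x ∈ (LinearMap.ker B)ᗮ := fun x hx => by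
      simpa [hA0 x hx] using hB.apply_mem_orthogonal_ker x
    rw [LinearMap.det_eq_det_restrict_mul_det_restrict hc (A + B) hp hq,
      detPrime_eq_det_restrict fun x _ => hA.apply_mem_orthogonal_ker x,
      detPrime_eq_det_restrict fun x _ => hB.apply_mem_orthogonal_ker x]
    congr 2
    · ext x
      simp [hB0 x x.2]
    · ext x
      simp [hA0 x x.2]

end SymmetricPair

/-- For an acyclic complex of finite-dimensional complex inner product
spaces, for every `0 ≤ k ≤ n` the Laplacian `Δ_k` is invertible and
`det Δ_k = det′(d_{k−1} ∘ d_{k−1}†) · det′(d_k† ∘ d_k)`. -/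
theorem stmt13 [∀ k, NormedAddCommGroup (V k)] [∀ k, InnerProductSpace ℂ (V k)]
    [∀ k, FiniteDimensional ℂ (V k)]
    (n : ℕ) (d : ∀ k, V k →ₗ[ℂ] V (k + 1))
    (hcomp : ∀ k, (d (k + 1)).comp (d k) = 0)
    (hzero : ∀ k, n ≤ k → d k = 0)
    (hker0 : LinearMap.ker (d 0) = ⊥)
    (hacyc : ∀ k, k < n → LinearMap.ker (d (k + 1)) = LinearMap.range (d k)) :
    ∀ k ≤ n, Function.Bijective (Lap d k) ∧
      LinearMap.det (Lap d k) =
        detPrime (ddAdj d k) * detPrime ((LinearMap.adjoint (d k)).comp (d k)) := by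
  intro k hk
  have hB : ((LinearMap.adjoint (d k)).comp (d k)).IsSymmetric :=
    (d k).isSymmetric_adjoint_comp_self
  cases k with
  | zero =>
    refine bijective_add_and_det_add_eq (fun x y => by simp [ddAdj]) hB ?_
    rw [LinearMap.ker_adjoint_comp_self, hker0, Submodule.bot_orthogonal_eq_top]
    exact LinearMap.ker_zero
  | succ k =>
    refine bijective_add_and_det_add_eq (A := (d k).comp (LinearMap.adjoint (d k)))
      (d k).isSymmetric_self_comp_adjoint hB ?_
    rw [LinearMap.ker_adjoint_comp_self, LinearMap.ker_self_comp_adjoint, hacyc k hk,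
      LinearMap.orthogonal_range]
end

section
/- The alternating product of the determinants of the Laplacians is trivial: ∏_{k=0}^{n} det(Δ_k)^{(−1)^k} = 1. -/
open LinearMap Module

variable {V : ℕ → Type}

section Auxiliary

variable [∀ k, NormedAddCommGroup (V k)] [∀ k, InnerProductSpace ℂ (V k)]
  [∀ k, FiniteDimensional ℂ (V k)] {d : ∀ k, V k →ₗ[ℂ] V (k + 1)}

theorem d_comp_ddAdj (hcomp : ∀ k, (d (k + 1)).comp (d k) = 0) :
    ∀ (k : ℕ) (x : V k), d k (ddAdj d k x) = 0
  | 0, x => by simp [ddAdj]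
  | k + 1, x => by simpa [ddAdj] using LinearMap.congr_fun (hcomp k) (adjoint (d k) x)

theorem d_Lap (hcomp : ∀ k, (d (k + 1)).comp (d k) = 0) (k : ℕ) (x : V k) :
    d k (Lap d k x) = Lap d (k + 1) (d k x) := by
  have h : d (k + 1) (d k x) = 0 := LinearMap.congr_fun (hcomp k) x
  rw [Lap, LinearMap.add_apply, map_add, d_comp_ddAdj hcomp]
  simp [Lap, h, ddAdj]

theorem Lap_mem_ker (hcomp : ∀ k, (d (k + 1)).comp (d k) = 0) (k : ℕ) :
    ∀ x ∈ ker (d k), Lap d k x ∈ ker (d k) := by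
  intro x hx
  rw [mem_ker] at hx ⊢
  rw [d_Lap hcomp, hx, map_zero]

/-- The determinant of the Laplacian restricted to the cocycles `ker d_k`. -/
noncomputable def detCocycles (hcomp : ∀ k, (d (k + 1)).comp (d k) = 0) (k : ℕ) : ℂ :=
  LinearMap.det ((Lap d k).restrict (Lap_mem_ker hcomp k))

theorem ker_Lap_succ {k : ℕ} (hk : ker (d (k + 1)) = range (d k)) :
    ker (Lap d (k + 1)) = ⊥ := by
  rw [eq_bot_iff]
  intro x hx
  have h : inner ℂ (Lap d (k + 1) x) x = 0 := by rw [mem_ker.1 hx, inner_zero_left]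
  simp only [Lap, ddAdj, LinearMap.add_apply, LinearMap.comp_apply, inner_add_left,
    adjoint_inner_left] at h
  rw [← adjoint_inner_right] at h
  simp only [inner_self_eq_norm_sq_to_K] at h
  have h' : ‖adjoint (d k) x‖ ^ 2 + ‖d (k + 1) x‖ ^ 2 = 0 :=
    (RCLike.ofReal_eq_zero (K := ℂ)).1 (by exact_mod_cast h)
  have h₁ : adjoint (d k) x = 0 := by
    rw [← norm_eq_zero]
    nlinarith [sq_nonneg ‖adjoint (d k) x‖, sq_nonneg ‖d (k + 1) x‖]
  have h₂ : d (k + 1) x = 0 := by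
    rw [← norm_eq_zero]
    nlinarith [sq_nonneg ‖adjoint (d k) x‖, sq_nonneg ‖d (k + 1) x‖]
  have h₃ : x ∈ range (d k) := hk ▸ mem_ker.2 h₂
  obtain ⟨y, rfl⟩ := h₃
  rw [Submodule.mem_bot, ← inner_self_eq_zero (𝕜 := ℂ), ← adjoint_inner_right, h₁,
    inner_zero_right]

theorem detCocycles_succ_ne_zero (hcomp : ∀ k, (d (k + 1)).comp (d k) = 0) {k : ℕ}
    (hk : ker (d (k + 1)) = range (d k)) : detCocycles hcomp (k + 1) ≠ 0 := by
  intro h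
  refine (bot_lt_ker_of_det_eq_zero h).ne' (ker_eq_bot'.2 fun x hx ↦ ?_)
  have hx' : (x : V (k + 1)) ∈ ker (Lap d (k + 1)) := congrArg Subtype.val hx
  rw [ker_Lap_succ hk] at hx'
  exact Subtype.ext hx'

theorem detCocycles_zero (hcomp : ∀ k, (d (k + 1)).comp (d k) = 0)
    (hker0 : ker (d 0) = ⊥) : detCocycles hcomp 0 = 1 := by
  have : Subsingleton (ker (d 0)) := by rw [hker0]; infer_instance
  exact det_eq_one_of_subsingleton _

theorem det_Lap_eq_mul (hcomp : ∀ k, (d (k + 1)).comp (d k) = 0) {k : ℕ}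
    (hk : ker (d (k + 1)) = range (d k)) :
    LinearMap.det (Lap d k) = detCocycles hcomp k * detCocycles hcomp (k + 1) := by
  rw [det_eq_det_mul_det (ker (d k)) (Lap d k) (Lap_mem_ker hcomp k)]
  let e : (V k ⧸ ker (d k)) ≃ₗ[ℂ] ker (d (k + 1)) :=
    (d k).quotKerEquivRange.trans (LinearEquiv.ofEq _ _ hk.symm)
  have he : (Lap d (k + 1)).restrict (Lap_mem_ker hcomp (k + 1)) =
      (e : _ →ₗ[ℂ] _) ∘ₗ (ker (d k)).mapQ (ker (d k)) (Lap d k) (Lap_mem_ker hcomp k) ∘ₗ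
        (e.symm : _ →ₗ[ℂ] _) := by
    refine LinearMap.ext fun y ↦ ?_
    obtain ⟨q, rfl⟩ := e.surjective y
    obtain ⟨x, rfl⟩ := Submodule.Quotient.mk_surjective _ q
    refine Subtype.ext ?_
    rw [LinearMap.comp_apply, LinearMap.comp_apply, LinearEquiv.coe_coe, LinearEquiv.coe_coe,
      e.symm_apply_apply]
    exact (d_Lap hcomp k x).symm
  rw [detCocycles, detCocycles, he, det_conj]

theorem det_Lap_of_d_eq_zero (hcomp : ∀ k, (d (k + 1)).comp (d k) = 0) {k : ℕ}
    (hk : d k = 0) : LinearMap.det (Lap d k) = detCocycles hcomp k := by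
  rw [det_eq_det_mul_det (ker (d k)) (Lap d k) (Lap_mem_ker hcomp k)]
  have : Subsingleton (V k ⧸ ker (d k)) := by
    rw [Submodule.Quotient.subsingleton_iff, hk, ker_zero]
  rw [det_eq_one_of_subsingleton (Submodule.mapQ _ _ _ _), mul_one, detCocycles]

theorem prod_det_Lap (hcomp : ∀ k, (d (k + 1)).comp (d k) = 0) (hker0 : ker (d 0) = ⊥)
    {n : ℕ} (hacyc : ∀ k, k < n → ker (d (k + 1)) = range (d k)) {m : ℕ} (hm : m ≤ n) :
    (∏ k ∈ Finset.range m, LinearMap.det (Lap d k) ^ ((-1 : ℤ) ^ k)) *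
      detCocycles hcomp m ^ ((-1 : ℤ) ^ m) = 1 := by
  induction m with
  | zero => simp [detCocycles_zero hcomp hker0]
  | succ m ih =>
    have h := detCocycles_succ_ne_zero hcomp (hacyc m hm)
    rw [Finset.prod_range_succ, det_Lap_eq_mul hcomp (hacyc m hm), mul_zpow, pow_succ,
      mul_neg_one, zpow_neg, mul_assoc, mul_inv_cancel_right₀ (zpow_ne_zero _ h)]
    exact ih (by omega)

end Auxiliary

/-- For an acyclic complex of finite-dimensional complex inner product
spaces, the alternating product of the determinants of the Laplacians is trivial:
`∏_{k=0}^{n} (det Δ_k)^{(−1)^k} = 1`. -/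
theorem stmt14 [∀ k, NormedAddCommGroup (V k)] [∀ k, InnerProductSpace ℂ (V k)]
    [∀ k, FiniteDimensional ℂ (V k)]
    (n : ℕ) (d : ∀ k, V k →ₗ[ℂ] V (k + 1))
    (hcomp : ∀ k, (d (k + 1)).comp (d k) = 0)
    (hzero : ∀ k, n ≤ k → d k = 0)
    (hker0 : LinearMap.ker (d 0) = ⊥)
    (hacyc : ∀ k, k < n → LinearMap.ker (d (k + 1)) = LinearMap.range (d k)) :
    ∏ k ∈ Finset.range (n + 1), LinearMap.det (Lap d k) ^ ((-1 : ℤ) ^ k) = 1 := by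
  rw [Finset.prod_range_succ, det_Lap_of_d_eq_zero hcomp (hzero n le_rfl)]
  exact prod_det_Lap hcomp hker0 hacyc le_rfl
end

section
/- Each det(Δ_k) is a positive real number, and if n is even and det(Δ_k) = det(Δ_{n−k}) for all 0 ≤ k ≤ n, then ∏_{k=0}^{n} det(Δ_k)^{(−1)^k · k} = 1. -/
open LinearMap Module

variable {V : ℕ → Type}

/-- The Weinstein–Aronszajn identity for linear maps. -/
theorem LinearMap.det_one_add_comp_comm {E F : Type*} [AddCommGroup E] [Module ℂ E]
    [FiniteDimensional ℂ E] [AddCommGroup F] [Module ℂ F] [FiniteDimensional ℂ F]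
    (S : E →ₗ[ℂ] F) (T : F →ₗ[ℂ] E) :
    LinearMap.det (1 + S ∘ₗ T) = LinearMap.det (1 + T ∘ₗ S) := by
  let b := Module.finBasis ℂ E
  let c := Module.finBasis ℂ F
  rw [← LinearMap.det_toMatrix c, ← LinearMap.det_toMatrix b, map_add, map_add,
    LinearMap.toMatrix_comp c b c, LinearMap.toMatrix_comp b c b,
    LinearMap.toMatrix_one, LinearMap.toMatrix_one, Matrix.det_one_add_mul_comm]

theorem LinearMap.IsPositive.exists_det_eq_ofReal {E : Type*} [NormedAddCommGroup E]
    [InnerProductSpace ℂ E] [FiniteDimensional ℂ E] {T : E →ₗ[ℂ] E} (hT : T.IsPositive) :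
    ∃ r : ℝ, 0 ≤ r ∧ LinearMap.det T = r := by
  refine ⟨∏ i, hT.isSymmetric.eigenvalues rfl i,
    Finset.prod_nonneg fun i _ => hT.nonneg_eigenvalues rfl i, ?_⟩
  rw [hT.isSymmetric.det_eq_prod_eigenvalues rfl]
  simp

section Gram

variable {E F G : Type*} [NormedAddCommGroup E] [InnerProductSpace ℂ E] [FiniteDimensional ℂ E]
  [NormedAddCommGroup F] [InnerProductSpace ℂ F] [FiniteDimensional ℂ F]
  [NormedAddCommGroup G] [InnerProductSpace ℂ G] [FiniteDimensional ℂ G]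

/-- `f† ∘ f` made invertible by adding the orthogonal projection onto `ker f`; its determinant is
the product of the nonzero eigenvalues of `f† ∘ f`. -/
noncomputable def gram (f : E →ₗ[ℂ] F) : E →ₗ[ℂ] E :=
  LinearMap.adjoint f ∘ₗ f + (LinearMap.ker f).starProjection.toLinearMap

theorem exists_pseudoinverse (f : E →ₗ[ℂ] F) :
    ∃ h : F →ₗ[ℂ] E, h ∘ₗ f = 1 - (LinearMap.ker f).starProjection.toLinearMap ∧
      f ∘ₗ h = (LinearMap.range f).starProjection.toLinearMap := by
  obtain ⟨s, hs⟩ := f.rangeRestrict.exists_rightInverse_of_surjective f.range_rangeRestrict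
  have hs' (y : LinearMap.range f) : f (s y) = y := congrArg Subtype.val (LinearMap.congr_fun hs y)
  refine ⟨(1 - (LinearMap.ker f).starProjection.toLinearMap) ∘ₗ s ∘ₗ
    (LinearMap.range f).orthogonalProjectionOnto.toLinearMap, ?_, ?_⟩
  · ext x
    have h1 : (LinearMap.range f).orthogonalProjectionOnto (f x) = ⟨f x, x, rfl⟩ :=
      Submodule.orthogonalProjectionOnto_mem_subspace_eq_self (K := LinearMap.range f) ⟨f x, x, rfl⟩
    have h2 : (LinearMap.ker f).starProjection (s ⟨f x, x, rfl⟩ - x) = s ⟨f x, x, rfl⟩ - x := by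
      rw [Submodule.starProjection_eq_self_iff, LinearMap.mem_ker, map_sub, hs', sub_self]
    rw [map_sub, sub_eq_sub_iff_sub_eq_sub, ← neg_inj, neg_sub, neg_sub] at h2
    simpa [h1] using h2
  · ext y
    have h1 (x : E) : f ((LinearMap.ker f).starProjection x) = 0 :=
      (LinearMap.ker f).starProjection_apply_mem x
    simp [h1, hs']

theorem det_gram (f : E →ₗ[ℂ] F) :
    LinearMap.det (gram f) = LinearMap.det
      (f ∘ₗ LinearMap.adjoint f + (1 - (LinearMap.range f).starProjection.toLinearMap)) := by
  obtain ⟨h, hf, fh⟩ := exists_pseudoinverse f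
  have := LinearMap.det_one_add_comp_comm (LinearMap.adjoint f - h) f
  rw [LinearMap.sub_comp, LinearMap.comp_sub, hf, fh] at this
  convert this using 2
  · rw [gram]; abel
  · abel

theorem det_add_gram {f : E →ₗ[ℂ] F} {g : F →ₗ[ℂ] G}
    (hfg : LinearMap.ker g = LinearMap.range f) :
    LinearMap.det (f ∘ₗ LinearMap.adjoint f + LinearMap.adjoint g ∘ₗ g) =
      LinearMap.det (gram f) * LinearMap.det (gram g) := by
  have hgf : g ∘ₗ f = 0 := LinearMap.range_le_ker_iff.mp hfg.ge
  set p : F →ₗ[ℂ] F := (LinearMap.range f).starProjection.toLinearMap with hp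
  have hpadj : LinearMap.adjoint p = p :=
    (LinearMap.isSymmetric_iff_isSelfAdjoint p).mp
      (LinearMap.range f).starProjection_isSymmetric
  have hpf : p ∘ₗ f = f := by
    ext x
    exact Submodule.starProjection_eq_self_iff.mpr ⟨x, rfl⟩
  have hgp : g ∘ₗ p = 0 := by
    ext x
    have : p x ∈ LinearMap.ker g := hfg ▸ (LinearMap.range f).starProjection_apply_mem x
    exact this
  have hfp : LinearMap.adjoint f ∘ₗ p = LinearMap.adjoint f := by
    rw [← hpadj, ← LinearMap.adjoint_comp, hpf]
  have hpg : p ∘ₗ LinearMap.adjoint g = 0 := by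
    rw [← hpadj, ← LinearMap.adjoint_comp, hgp, map_zero]
  have hfg' : LinearMap.adjoint f ∘ₗ LinearMap.adjoint g = 0 := by
    rw [← LinearMap.adjoint_comp, hgf, map_zero]
  have hpp : p ∘ₗ p = p := by
    ext x
    exact Submodule.starProjection_eq_self_iff.mpr
      ((LinearMap.range f).starProjection_apply_mem x)
  have hgg : gram g = LinearMap.adjoint g ∘ₗ g + p := by simp only [gram, hfg, hp]
  rw [det_gram, ← hp, hgg, ← LinearMap.det_comp]
  congr 1
  ext x
  have e1 y : LinearMap.adjoint f (p y) = LinearMap.adjoint f y := LinearMap.congr_fun hfp y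
  have e2 y : p (LinearMap.adjoint g y) = 0 := LinearMap.congr_fun hpg y
  have e3 y : LinearMap.adjoint f (LinearMap.adjoint g y) = 0 := LinearMap.congr_fun hfg' y
  have e4 y : p (p y) = p y := LinearMap.congr_fun hpp y
  simp [e1, e2, e3, e4]

theorem det_add_ne_zero {f : E →ₗ[ℂ] F} {g : F →ₗ[ℂ] G}
    (hfg : LinearMap.ker g = LinearMap.range f) :
    LinearMap.det (f ∘ₗ LinearMap.adjoint f + LinearMap.adjoint g ∘ₗ g) ≠ 0 := by
  intro h0
  have hgf : g ∘ₗ f = 0 := LinearMap.range_le_ker_iff.mp hfg.ge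
  obtain ⟨x, hx, hx0⟩ := Submodule.exists_mem_ne_zero_of_ne_bot
    (LinearMap.bot_lt_ker_of_det_eq_zero h0).ne'
  have h1 : inner ℂ (LinearMap.adjoint f x) (LinearMap.adjoint f x) +
      inner ℂ (g x) (g x) = 0 := by
    rw [LinearMap.adjoint_inner_right, ← LinearMap.adjoint_inner_left, ← inner_add_left]
    have : f (LinearMap.adjoint f x) + LinearMap.adjoint g (g x) = 0 := hx
    rw [this, inner_zero_left]
  have h2 : ‖LinearMap.adjoint f x‖ ^ 2 + ‖g x‖ ^ 2 = 0 := by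
    rw [inner_self_eq_norm_sq_to_K, inner_self_eq_norm_sq_to_K] at h1
    apply Complex.ofReal_injective
    simpa using h1
  have hg : g x = 0 := by
    rw [← norm_eq_zero]; nlinarith [sq_nonneg ‖LinearMap.adjoint f x‖, sq_nonneg ‖g x‖]
  have hf : LinearMap.adjoint f x = 0 := by
    rw [← norm_eq_zero]; nlinarith [sq_nonneg ‖LinearMap.adjoint f x‖, sq_nonneg ‖g x‖]
  obtain ⟨y, rfl⟩ : x ∈ LinearMap.range f := hfg ▸ hg
  apply hx0
  rw [← inner_self_eq_zero (𝕜 := ℂ), ← LinearMap.adjoint_inner_left, hf, inner_zero_left]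

end Gram

theorem prod_zpow_alternating_of_eq_mul {a b : ℕ → ℝ} (n : ℕ) (hb : ∀ k, k < n → b k ≠ 0)
    (h0 : a 0 = b 0) (hs : ∀ k, k < n → a (k + 1) = b k * b (k + 1)) :
    ∏ k ∈ Finset.range (n + 1), a k ^ ((-1 : ℤ) ^ k) = b n ^ ((-1 : ℤ) ^ n) := by
  induction n with
  | zero => simp [h0]
  | succ n ih =>
    rw [Finset.prod_range_succ, ih (fun k hk => hb k (by omega)) (fun k hk => hs k (by omega)),
      hs n (by omega), mul_zpow, ← mul_assoc, pow_succ, mul_neg_one, zpow_neg, zpow_neg,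
      mul_inv_cancel₀ (zpow_ne_zero _ (hb n (by omega))), one_mul]

theorem prod_zpow_weighted_eq_one {a : ℕ → ℝ} {n : ℕ} (hn : Even n) (ha : ∀ k ≤ n, 0 < a k)
    (hsymm : ∀ k ≤ n, a k = a (n - k))
    (h1 : ∏ k ∈ Finset.range (n + 1), a k ^ ((-1 : ℤ) ^ k) = 1) :
    ∏ k ∈ Finset.range (n + 1), a k ^ ((-1 : ℤ) ^ k * (k : ℤ)) = 1 := by
  set P := ∏ k ∈ Finset.range (n + 1), a k ^ ((-1 : ℤ) ^ k * (k : ℤ)) with hP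
  have hpos : 0 < P := Finset.prod_pos fun k hk =>
    zpow_pos (ha k (by simpa [Nat.lt_succ_iff] using hk)) _
  have hsq : P * P = 1 := by
    have hrefl := Finset.prod_range_reflect (fun k => a k ^ ((-1 : ℤ) ^ k * (k : ℤ))) (n + 1)
    nth_rewrite 1 [hP, ← hrefl]
    rw [hP]
    rw [← Finset.prod_mul_distrib, ← one_zpow (n : ℤ), ← h1, ← Finset.prod_zpow]
    refine Finset.prod_congr rfl fun k hk => ?_
    have hk : k ≤ n := by simpa [Nat.lt_succ_iff] using hk
    have hpar : (-1 : ℤ) ^ (n - k) = (-1) ^ k := by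
      rw [neg_one_pow_congr]
      grind
    rw [Nat.add_sub_cancel, ← hsymm k hk, hpar, ← zpow_add₀ (ha k hk).ne', ← zpow_mul,
      ← mul_add, Nat.cast_sub hk, sub_add_cancel]
  nlinarith

/-- For an acyclic complex of finite-dimensional complex inner product
spaces, each `det Δ_k` is a positive real number, and if `n` is even and
`det Δ_k = det Δ_{n−k}` for all `0 ≤ k ≤ n`, then `∏_{k=0}^{n} (det Δ_k)^{(−1)^k·k} = 1`. -/
theorem stmt15 [∀ k, NormedAddCommGroup (V k)] [∀ k, InnerProductSpace ℂ (V k)]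
    [∀ k, FiniteDimensional ℂ (V k)]
    (n : ℕ) (d : ∀ k, V k →ₗ[ℂ] V (k + 1))
    (hcomp : ∀ k, (d (k + 1)).comp (d k) = 0)
    (hzero : ∀ k, n ≤ k → d k = 0)
    (hker0 : LinearMap.ker (d 0) = ⊥)
    (hacyc : ∀ k, k < n → LinearMap.ker (d (k + 1)) = LinearMap.range (d k)) :
    (∀ k ≤ n, (LinearMap.det (Lap d k)).im = 0 ∧ 0 < (LinearMap.det (Lap d k)).re) ∧
    (Even n → (∀ k ≤ n, LinearMap.det (Lap d k) = LinearMap.det (Lap d (n - k))) →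
      ∏ k ∈ Finset.range (n + 1),
        LinearMap.det (Lap d k) ^ ((-1 : ℤ) ^ k * (k : ℤ)) = 1) := by
  have hLap0 : Lap d 0 = LinearMap.adjoint (d 0) ∘ₗ d 0 := zero_add _
  have hzero' : LinearMap.ker (d 0) = LinearMap.range (0 : V 0 →ₗ[ℂ] V 0) := by
    rw [hker0, LinearMap.range_zero]
  have hLap0' : Lap d 0 = (0 : V 0 →ₗ[ℂ] V 0) ∘ₗ LinearMap.adjoint 0 +
      LinearMap.adjoint (d 0) ∘ₗ d 0 := by
    rw [LinearMap.zero_comp, hLap0]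
    exact (zero_add _).symm
  have hpositive (k : ℕ) : (Lap d k).IsPositive := by
    cases k with
    | zero => exact hLap0 ▸ (d 0).isPositive_adjoint_comp_self
    | succ k =>
      exact (d k).isPositive_self_comp_adjoint.add (d (k + 1)).isPositive_adjoint_comp_self
  have hne (k : ℕ) (hk : k ≤ n) : LinearMap.det (Lap d k) ≠ 0 := by
    cases k with
    | zero => exact hLap0' ▸ det_add_ne_zero hzero'
    | succ k => exact det_add_ne_zero (hacyc k hk)
  choose a ha0 ha using fun k => (hpositive k).exists_det_eq_ofReal
  have hapos (k : ℕ) (hk : k ≤ n) : 0 < a k :=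
    (ha0 k).lt_of_ne' fun h => hne k hk (by rw [ha, h, Complex.ofReal_zero])
  have hgram_pos (k : ℕ) : (gram (d k)).IsPositive :=
    (d k).isPositive_adjoint_comp_self.add
      (ContinuousLinearMap.isPositive_toLinearMap_iff _ |>.mpr
        (ContinuousLinearMap.IsPositive.of_isStarProjection isStarProjection_starProjection))
  choose b _ hb using fun k => (hgram_pos k).exists_det_eq_ofReal
  have hab0 : a 0 = b 0 := by
    have : gram (d 0) = Lap d 0 := by
      simp [gram, hLap0, hker0]
    exact Complex.ofReal_injective (by rw [← ha, ← hb, this])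
  have hab (k : ℕ) (hk : k < n) : a (k + 1) = b k * b (k + 1) :=
    Complex.ofReal_injective (by
      rw [Complex.ofReal_mul, ← ha, ← hb, ← hb]
      exact det_add_gram (hacyc k hk))
  have hbn : b n = 1 := by
    have : gram (d n) = 1 := by
      simp [gram, hzero n le_rfl, Submodule.starProjection_top']
    exact Complex.ofReal_injective (by rw [← hb, this, map_one, Complex.ofReal_one])
  simp only [ha]
  refine ⟨fun k hk => ⟨Complex.ofReal_im _, hapos k hk⟩, fun hn hsymm => ?_⟩
  have hprod := prod_zpow_weighted_eq_one hn hapos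
    (fun k hk => Complex.ofReal_injective (hsymm k hk))
    (by
      rw [prod_zpow_alternating_of_eq_mul n _ hab0 hab, hbn, one_zpow]
      exact fun k hk h => (hapos (k + 1) hk).ne' (by rw [hab k hk, h, zero_mul]))
  exact_mod_cast congrArg Complex.ofReal hprod
end

section
/- For every 0 ≤ k ≤ n−1 and every λ ∈ ℂ with λ ≠ 0: dim ker(d_k† ∘ d_k − λ·id) = Σ_{j=0}^{k} (−1)^j · dim ker(Δ_{k−j} − λ·id). -/
open LinearMap Module

variable {V : ℕ → Type}

/-- If `f ∘ g = g ∘ f = 0`, the multiplicity of a nonzero eigenvalue of `f + g` is the sum of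
its multiplicities for `f` and `g`. -/
theorem finrank_ker_add_sub_smul_id {K W : Type*} [Field K] [AddCommGroup W] [Module K W]
    [FiniteDimensional K W] {f g : W →ₗ[K] W} (hfg : f.comp g = 0) (hgf : g.comp f = 0)
    {c : K} (hc : c ≠ 0) :
    finrank K (ker (f + g - c • LinearMap.id)) =
      finrank K (ker (f - c • LinearMap.id)) + finrank K (ker (g - c • LinearMap.id)) := by
  have hfg' (x : W) : f (g x) = 0 := LinearMap.congr_fun hfg x
  have hgf' (x : W) : g (f x) = 0 := LinearMap.congr_fun hgf x
  have hsup : ker (f - c • LinearMap.id) ⊔ ker (g - c • LinearMap.id) =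
      ker (f + g - c • LinearMap.id) := by
    apply le_antisymm
    · refine sup_le (fun x hx ↦ ?_) fun x hx ↦ ?_ <;>
        simp only [LinearMap.mem_ker, LinearMap.sub_apply, LinearMap.add_apply,
          LinearMap.smul_apply, LinearMap.id_apply, sub_eq_zero] at hx ⊢
      · have h : c • g x = 0 := by rw [← map_smul, ← hx, hgf']
        rw [(smul_eq_zero_iff_right hc).mp h, add_zero, hx]
      · have h : c • f x = 0 := by rw [← map_smul, ← hx, hfg']
        rw [(smul_eq_zero_iff_right hc).mp h, zero_add, hx]
    · intro x hx
      simp only [LinearMap.mem_ker, LinearMap.sub_apply, LinearMap.add_apply,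
        LinearMap.smul_apply, LinearMap.id_apply, sub_eq_zero] at hx
      have hf : f (f x) = c • f x := by rw [← map_smul, ← hx, map_add, hfg', add_zero]
      have hg : g (g x) = c • g x := by rw [← map_smul, ← hx, map_add, hgf', zero_add]
      refine Submodule.mem_sup.mpr ⟨c⁻¹ • f x, ?_, c⁻¹ • g x, ?_, ?_⟩
      · simp [hf]
      · simp [hg]
      · rw [← smul_add, hx, inv_smul_smul₀ hc]
  have hinf : ker (f - c • LinearMap.id) ⊓ ker (g - c • LinearMap.id) = ⊥ := by
    refine (Submodule.eq_bot_iff _).mpr fun x ⟨hx, hx'⟩ ↦ ?_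
    simp only [SetLike.mem_coe, LinearMap.mem_ker, LinearMap.sub_apply, LinearMap.smul_apply,
      LinearMap.id_apply, sub_eq_zero] at hx hx'
    have h : c • c • x = 0 := by rw [← hx', ← map_smul, ← hx, hgf']
    exact (smul_eq_zero_iff_right hc).mp ((smul_eq_zero_iff_right hc).mp h)
  rw [← hsup, ← Submodule.finrank_sup_add_finrank_inf_eq, hinf, finrank_bot, add_zero]

theorem finrank_ker_comp_sub_smul_id_le {K U W : Type*} [Field K] [AddCommGroup U] [Module K U]
    [AddCommGroup W] [Module K W] [FiniteDimensional K W] (f : U →ₗ[K] W) (g : W →ₗ[K] U)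
    {c : K} (hc : c ≠ 0) :
    finrank K (ker (g.comp f - c • LinearMap.id)) ≤
      finrank K (ker (f.comp g - c • LinearMap.id)) := by
  have hmem : ∀ x ∈ ker (g.comp f - c • LinearMap.id),
      f x ∈ ker (f.comp g - c • LinearMap.id) := by
    intro x hx
    simp only [LinearMap.mem_ker, LinearMap.sub_apply, LinearMap.comp_apply,
      LinearMap.smul_apply, LinearMap.id_apply, sub_eq_zero] at hx ⊢
    rw [hx, map_smul]
  refine LinearMap.finrank_le_finrank_of_injective (f := f.restrict hmem)
    ((injective_iff_map_eq_zero _).mpr ?_)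
  rintro ⟨x, hx⟩ h
  have hfx : f x = 0 := congrArg Subtype.val h
  simp only [LinearMap.mem_ker, LinearMap.sub_apply, LinearMap.comp_apply,
    LinearMap.smul_apply, LinearMap.id_apply, hfx, map_zero, zero_sub, neg_eq_zero] at hx
  exact Subtype.ext ((smul_eq_zero_iff_right hc).mp hx)

/-- `g ∘ f` and `f ∘ g` have the same nonzero eigenvalues with the same multiplicities. -/
theorem finrank_ker_comp_sub_smul_id_comm {K U W : Type*} [Field K] [AddCommGroup U]
    [Module K U] [FiniteDimensional K U] [AddCommGroup W] [Module K W] [FiniteDimensional K W]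
    (f : U →ₗ[K] W) (g : W →ₗ[K] U) {c : K} (hc : c ≠ 0) :
    finrank K (ker (g.comp f - c • LinearMap.id)) =
      finrank K (ker (f.comp g - c • LinearMap.id)) :=
  (finrank_ker_comp_sub_smul_id_le f g hc).antisymm (finrank_ker_comp_sub_smul_id_le g f hc)

theorem finrank_ker_Lap_zero [∀ k, NormedAddCommGroup (V k)]
    [∀ k, InnerProductSpace ℂ (V k)] [∀ k, FiniteDimensional ℂ (V k)]
    (d : ∀ k, V k →ₗ[ℂ] V (k + 1)) (c : ℂ) :
    finrank ℂ (ker (Lap d 0 - c • LinearMap.id)) =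
      finrank ℂ (ker ((LinearMap.adjoint (d 0)).comp (d 0) - c • LinearMap.id)) := by
  have h : Lap d 0 = (LinearMap.adjoint (d 0)).comp (d 0) := zero_add _
  rw [h]

theorem finrank_ker_Lap_succ [∀ k, NormedAddCommGroup (V k)]
    [∀ k, InnerProductSpace ℂ (V k)] [∀ k, FiniteDimensional ℂ (V k)]
    (d : ∀ k, V k →ₗ[ℂ] V (k + 1)) (k : ℕ) (hcomp : (d (k + 1)).comp (d k) = 0)
    {c : ℂ} (hc : c ≠ 0) :
    finrank ℂ (ker (Lap d (k + 1) - c • LinearMap.id)) =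
      finrank ℂ (ker ((LinearMap.adjoint (d k)).comp (d k) - c • LinearMap.id)) +
      finrank ℂ
        (ker ((LinearMap.adjoint (d (k + 1))).comp (d (k + 1)) - c • LinearMap.id)) := by
  have hadj : (LinearMap.adjoint (d k)).comp (LinearMap.adjoint (d (k + 1))) = 0 := by
    rw [← LinearMap.adjoint_comp, hcomp, map_zero]
  rw [finrank_ker_comp_sub_smul_id_comm (d k) _ hc]
  refine finrank_ker_add_sub_smul_id (f := (d k).comp (LinearMap.adjoint (d k))) ?_ ?_ hc
  · rw [LinearMap.comp_assoc, ← LinearMap.comp_assoc (d (k + 1)), hadj, LinearMap.zero_comp,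
      LinearMap.comp_zero]
  · rw [LinearMap.comp_assoc, ← LinearMap.comp_assoc _ (d k), hcomp, LinearMap.zero_comp,
      LinearMap.comp_zero]

theorem eq_sum_range_neg_one_pow_mul_of_succ_eq_add {R : Type*} [CommRing R] {a b : ℕ → R}
    (h_zero : b 0 = a 0) (h_succ : ∀ k, b (k + 1) = a k + a (k + 1)) (k : ℕ) :
    a k = ∑ j ∈ Finset.range (k + 1), (-1) ^ j * b (k - j) := by
  induction k with
  | zero => simp [h_zero]
  | succ k ih =>
    rw [Finset.sum_range_succ']
    simp only [pow_succ, Nat.add_sub_add_right, mul_neg_one, neg_mul, Finset.sum_neg_distrib,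
      pow_zero, one_mul, Nat.sub_zero]
    rw [← ih, h_succ]
    ring

/-- For an acyclic complex of finite-dimensional complex inner product
spaces, every `0 ≤ k ≤ n−1` and every `lam ≠ 0`:
`dim ker (d_k† ∘ d_k − lam·id) = Σ_{j=0}^{k} (−1)^j · dim ker (Δ_{k−j} − lam·id)`. -/
theorem stmt18 [∀ k, NormedAddCommGroup (V k)] [∀ k, InnerProductSpace ℂ (V k)]
    [∀ k, FiniteDimensional ℂ (V k)]
    (n : ℕ) (d : ∀ k, V k →ₗ[ℂ] V (k + 1))
    (hcomp : ∀ k, (d (k + 1)).comp (d k) = 0)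
    (hzero : ∀ k, n ≤ k → d k = 0)
    (hker0 : LinearMap.ker (d 0) = ⊥)
    (hacyc : ∀ k, k < n → LinearMap.ker (d (k + 1)) = LinearMap.range (d k)) :
    ∀ k < n, ∀ lam : ℂ, lam ≠ 0 →
      (Module.finrank ℂ
        (LinearMap.ker ((LinearMap.adjoint (d k)).comp (d k) - lam • LinearMap.id)) : ℤ) =
      ∑ j ∈ Finset.range (k + 1), (-1 : ℤ) ^ j *
        (Module.finrank ℂ (LinearMap.ker (Lap d (k - j) - lam • LinearMap.id)) : ℤ) := by
  intro k _ lam hlam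
  let a (k : ℕ) : ℤ :=
    finrank ℂ (ker ((LinearMap.adjoint (d k)).comp (d k) - lam • LinearMap.id))
  let b (k : ℕ) : ℤ := finrank ℂ (ker (Lap d k - lam • LinearMap.id))
  have h_zero : b 0 = a 0 := congrArg Nat.cast (finrank_ker_Lap_zero d lam)
  have h_succ (k : ℕ) : b (k + 1) = a k + a (k + 1) := by
    rw [← Nat.cast_add, ← finrank_ker_Lap_succ d k (hcomp k) hlam]
  exact eq_sum_range_neg_one_pow_mul_of_succ_eq_add h_zero h_succ k
end
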